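/- arXiv:math/0406185 — 8 statements merged into one kernel-verified Lean document; each statement's English description precedes it below -/
import Mathlib

section
/- Let F, ξ : ℝ² → ℂ be C¹ functions of (u,v) and r ∈ ℝ. For α₀ ∈ ℂ and t₀ ∈ ℝ, set F' = F + (1/2)(α₀ − 2t₀ξ − conj(α₀)ξ²) and r' = r + (conj(α₀)ξ + α₀conj(ξ) + t₀(1 − ξconj(ξ)))/(1 + ξconj(ξ)). Then the translated derivatives computed from (F', r') agree with those computed from (F, r): ∂F' + r'·∂ξ − 2F'conj(ξ)∂ξ/(1+ξconj(ξ)) = ∂F + r·∂ξ − 2Fconj(ξ)∂ξ/(1+ξconj(ξ)), and likewise with ∂ replaced by ∂̄ throughout. -/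
open Complex
open scoped ComplexConjugate

/-- Wirtinger derivative ∂ = (1/2)(∂/∂u − i ∂/∂v) of a complex-valued function of (u,v). -/
noncomputable def wd (f : ℝ × ℝ → ℂ) (p : ℝ × ℝ) : ℂ :=
  (1 / 2) * (fderiv ℝ f p (1, 0) - Complex.I * fderiv ℝ f p (0, 1))

/-- Wirtinger derivative ∂̄ = (1/2)(∂/∂u + i ∂/∂v). -/
noncomputable def wdb (f : ℝ × ℝ → ℂ) (p : ℝ × ℝ) : ℂ :=
  (1 / 2) * (fderiv ℝ f p (1, 0) + Complex.I * fderiv ℝ f p (0, 1))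

/-- ∂⁺F = ∂F + r·∂ξ − 2F·conj(ξ)·∂ξ/(1+ξ·conj(ξ)). -/
noncomputable def dplus (F ξ : ℝ × ℝ → ℂ) (r : ℝ) (p : ℝ × ℝ) : ℂ :=
  wd F p + r * wd ξ p - 2 * F p * conj (ξ p) * wd ξ p / (1 + ξ p * conj (ξ p))

/-- ∂⁻F = ∂̄F + r·∂̄ξ − 2F·conj(ξ)·∂̄ξ/(1+ξ·conj(ξ)). -/
noncomputable def dminus (F ξ : ℝ × ℝ → ℂ) (r : ℝ) (p : ℝ × ℝ) : ℂ :=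
  wdb F p + r * wdb ξ p - 2 * F p * conj (ξ p) * wdb ξ p / (1 + ξ p * conj (ξ p))

theorem one_add_mul_conj_ne_zero (z : ℂ) : 1 + z * conj z ≠ 0 := by
  rw [Complex.mul_conj]
  exact_mod_cast (add_pos_of_pos_of_nonneg one_pos (Complex.normSq_nonneg z)).ne'

/-- Derivative of the sum of `F` and a quadratic polynomial in `ξ`. -/
theorem fderiv_add_quadratic {E : Type*} [NormedAddCommGroup E] [NormedSpace ℝ E]
    {F ξ : E → ℂ} {p : E} (hF : DifferentiableAt ℝ F p) (hξ : DifferentiableAt ℝ ξ p)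
    (a b c : ℂ) (v : E) :
    fderiv ℝ (fun q => F q + (1 / 2) * (a - 2 * b * ξ q - c * (ξ q) ^ 2)) p v =
      fderiv ℝ F p v - (b + c * ξ p) * fderiv ℝ ξ p v := by
  have h := hF.hasFDerivAt.add ((((hξ.hasFDerivAt.const_mul (2 * b)).const_sub a).sub
    ((hξ.hasFDerivAt.pow 2).const_mul c)).const_mul (1 / 2))
  have h' : fderiv ℝ (fun q => F q + (1 / 2) * (a - 2 * b * ξ q - c * (ξ q) ^ 2)) p = _ :=
    h.fderiv
  rw [h']
  simp
  ring

/-- The algebraic cancellation behind translation invariance: `d` and `e` stand for the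
derivatives of `F` and `ξ`, and `z` for the value of `ξ`. -/
theorem translation_cancel (f z d e r a t : ℂ) :
    d - (t + conj a * z) * e +
        (r + (conj a * z + a * conj z + t * (1 - z * conj z)) / (1 + z * conj z)) * e -
        2 * (f + (1 / 2) * (a - 2 * t * z - conj a * z ^ 2)) * conj z * e / (1 + z * conj z) =
      d + r * e - 2 * f * conj z * e / (1 + z * conj z) := by
  have h := one_add_mul_conj_ne_zero z
  field_simp
  ring

/-- The translation-invariance of the derivatives ∂⁺F and ∂⁻F: translating the
origin of ℝ³ by (Re α₀, Im α₀, t₀) replaces (F, r) by (F', r'), and the translated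
derivatives computed from (F', r') agree with those computed from (F, r). -/
theorem translated_derivatives_invariant
    (F ξ : ℝ × ℝ → ℂ) (hF : ContDiff ℝ 1 F) (hξ : ContDiff ℝ 1 ξ)
    (r : ℝ) (α₀ : ℂ) (t₀ : ℝ) (p : ℝ × ℝ) :
    let F' : ℝ × ℝ → ℂ :=
      fun q => F q + (1 / 2) * (α₀ - 2 * (t₀ : ℂ) * ξ q - conj α₀ * (ξ q) ^ 2)
    let r' : ℝ × ℝ → ℂ :=
      fun q => (r : ℂ) +
        (conj α₀ * ξ q + α₀ * conj (ξ q) + (t₀ : ℂ) * (1 - ξ q * conj (ξ q))) /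
          (1 + ξ q * conj (ξ q))
    (wd F' p + r' p * wd ξ p - 2 * F' p * conj (ξ p) * wd ξ p / (1 + ξ p * conj (ξ p))
        = dplus F ξ r p) ∧
    (wdb F' p + r' p * wdb ξ p - 2 * F' p * conj (ξ p) * wdb ξ p / (1 + ξ p * conj (ξ p))
        = dminus F ξ r p) := by
  intro F' r'
  have hd := fderiv_add_quadratic (hF.differentiable one_ne_zero p)
    (hξ.differentiable one_ne_zero p) α₀ t₀ (conj α₀)
  have hw : wd F' p = wd F p - (t₀ + conj α₀ * ξ p) * wd ξ p := by
    simp only [wd, F', hd]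
    ring
  have hwb : wdb F' p = wdb F p - (t₀ + conj α₀ * ξ p) * wdb ξ p := by
    simp only [wdb, F', hd]
    ring
  rw [hw, hwb]
  exact ⟨translation_cancel _ _ _ _ _ _ _, translation_cancel _ _ _ _ _ _ _⟩
end

section
/- Let a, b, c, d ∈ ℂ and define, for r ∈ ℝ, P(r) = a + r·c, M(r) = b + r·d, D(r) = M(r)·conj(M(r)) − P(r)·conj(P(r)), ρ(r) = (P(r)·conj(c) − M(r)·conj(d))/D(r), and σ(r) = (conj(P(r))·conj(d) − conj(M(r))·conj(c))/D(r). Then at every r with D(r) ≠ 0, the Sachs equations hold: dρ/dr = ρ² + σ·conj(σ) and dσ/dr = (ρ + conj(ρ))·σ. -/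
open Complex
open scoped ComplexConjugate

/-- The derivative of the affine function `r ↦ a + r * c` of a real variable. -/
lemma hasDerivAt_add_ofReal_mul (a c : ℂ) (r : ℝ) :
    HasDerivAt (fun r : ℝ => a + (r : ℂ) * c) c r := by
  simpa using ((hasDerivAt_id r).ofReal_comp.mul_const c).const_add a

/-- The derivative of the conjugate of the affine function `r ↦ a + r * c`. -/
lemma hasDerivAt_conj_add_ofReal_mul (a c : ℂ) (r : ℝ) :
    HasDerivAt (fun r : ℝ => conj (a + (r : ℂ) * c)) (conj c) r := by
  simpa using hasDerivAt_add_ofReal_mul (conj a) (conj c) r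

/-- Along each line, with P(r) = a + rc (the value of ∂⁺F), M(r) = b + rd (the value
of ∂⁻F), D = M·conj(M) − P·conj(P), ρ = (P·conj(c) − M·conj(d))/D and
σ = (conj(P)·conj(d) − conj(M)·conj(c))/D, the optical scalars satisfy the Sachs
equations dρ/dr = ρ² + σ·conj(σ), dσ/dr = (ρ + conj(ρ))·σ wherever D ≠ 0. -/
theorem sachs_equations (a b c d : ℂ) :
    let P : ℝ → ℂ := fun r => a + (r : ℂ) * c
    let M : ℝ → ℂ := fun r => b + (r : ℂ) * d
    let D : ℝ → ℂ := fun r => M r * conj (M r) - P r * conj (P r)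
    let ρ : ℝ → ℂ := fun r => (P r * conj c - M r * conj d) / D r
    let σ : ℝ → ℂ := fun r => (conj (P r) * conj d - conj (M r) * conj c) / D r
    ∀ r : ℝ, D r ≠ 0 →
      HasDerivAt ρ (ρ r ^ 2 + σ r * conj (σ r)) r ∧
      HasDerivAt σ ((ρ r + conj (ρ r)) * σ r) r := by
  intro P M D ρ σ r hr
  have hP : HasDerivAt P c r := hasDerivAt_add_ofReal_mul a c r
  have hM : HasDerivAt M d r := hasDerivAt_add_ofReal_mul b d r
  have hP' : HasDerivAt (fun r => conj (P r)) (conj c) r := hasDerivAt_conj_add_ofReal_mul a c r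
  have hM' : HasDerivAt (fun r => conj (M r)) (conj d) r := hasDerivAt_conj_add_ofReal_mul b d r
  have hD : HasDerivAt D (d * conj (M r) + M r * conj d - (c * conj (P r) + P r * conj c)) r :=
    (hM.mul hM').sub (hP.mul hP')
  have hDconj : conj (D r) = D r := by
    simp only [D, map_sub, map_mul, conj_conj]
    ring
  have hDr : D r = M r * conj (M r) - P r * conj (P r) := rfl
  have hρ : ρ r = (P r * conj c - M r * conj d) / D r := rfl
  have hσ : σ r = (conj (P r) * conj d - conj (M r) * conj c) / D r := rfl
  constructor
  · refine (((hP.mul_const (conj c)).sub (hM.mul_const (conj d))).div hD hr).congr_deriv ?_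
    simp only [hρ, hσ, map_div₀, map_sub, map_mul, conj_conj, hDconj, Pi.sub_apply]
    field_simp
    rw [hDr]
    ring
  · refine (((hP'.mul_const (conj d)).sub (hM'.mul_const (conj c))).div hD hr).congr_deriv ?_
    simp only [hρ, hσ, map_div₀, map_sub, map_mul, conj_conj, hDconj, Pi.sub_apply]
    field_simp
    ring
end

section
/- Let I ⊆ ℝ be an open interval containing 0 and let ρ, σ : I → ℂ be differentiable functions satisfying the Sachs equations dρ/dr = ρ² + σ·conj(σ) and dσ/dr = (ρ + conj(ρ))·σ on I, with ρ(0) = ρ₀ and σ(0) = σ₀. Set Q(r) = 1 − (ρ₀ + conj(ρ₀))·r + (ρ₀·conj(ρ₀) − σ₀·conj(σ₀))·r². Then for every r ∈ I such that Q(s) ≠ 0 for all s in the closed interval between 0 and r, one has ρ(r) = (ρ₀ − (ρ₀·conj(ρ₀) − σ₀·conj(σ₀))·r)/Q(r) and σ(r) = σ₀/Q(r). -/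
open Complex
open scoped ComplexConjugate

/-- A solution of the linear system `u' = p u + q conj v`, `v' = p v + q conj u` with continuous
coefficients that vanishes at `0` vanishes on the whole interval. -/
lemma eq_zero_of_linear_conj_system {a b : ℝ} (ha : a < 0) (hb : 0 < b) {p q u v : ℝ → ℂ}
    (hp : ContinuousOn p (Set.Ioo a b)) (hq : ContinuousOn q (Set.Ioo a b))
    (hu : ∀ t ∈ Set.Ioo a b, HasDerivAt u (p t * u t + q t * conj (v t)) t)
    (hv : ∀ t ∈ Set.Ioo a b, HasDerivAt v (p t * v t + q t * conj (u t)) t)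
    (hu0 : u 0 = 0) (hv0 : v 0 = 0) {r : ℝ} (hr : r ∈ Set.Ioo a b) :
    u r = 0 ∧ v r = 0 := by
  obtain ⟨c, hac, hc⟩ := exists_between (lt_min ha hr.1)
  obtain ⟨d, hd, hdb⟩ := exists_between (max_lt hb hr.2)
  obtain ⟨hc0, hcr⟩ := lt_min_iff.1 hc
  obtain ⟨hd0, hrd⟩ := max_lt_iff.1 hd
  have hsub : Set.Icc c d ⊆ Set.Ioo a b := Set.Icc_subset_Ioo hac hdb
  obtain ⟨P, hP⟩ := isCompact_Icc.exists_bound_of_continuousOn (hp.mono hsub)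
  obtain ⟨R, hR⟩ := isCompact_Icc.exists_bound_of_continuousOn (hq.mono hsub)
  have h0 : (0 : ℝ) ∈ Set.Icc c d := ⟨hc0.le, hd0.le⟩
  have hP0 : 0 ≤ P := (norm_nonneg _).trans (hP 0 h0)
  have hR0 : 0 ≤ R := (norm_nonneg _).trans (hR 0 h0)
  have hbound : ∀ t ∈ Set.Ioo c d, ∀ z w : ℂ, ∀ m : ℝ, ‖z‖ ≤ m → ‖w‖ ≤ m →
      ‖p t * z + q t * conj w‖ ≤ (P + R) * m := by
    intro t ht z w m hz hw
    have ht' := Set.Ioo_subset_Icc_self ht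
    calc ‖p t * z + q t * conj w‖ ≤ ‖p t‖ * ‖z‖ + ‖q t‖ * ‖w‖ := by
          refine (norm_add_le _ _).trans_eq ?_
          rw [norm_mul, norm_mul, RCLike.norm_conj]
      _ ≤ P * m + R * m := by
          gcongr
          exacts [hP t ht', hR t ht']
      _ = (P + R) * m := by ring
  let F : ℝ → ℂ × ℂ → ℂ × ℂ := fun t x ↦
    (p t * x.1 + q t * conj x.2, p t * x.2 + q t * conj x.1)
  have hF : ∀ t ∈ Set.Ioo c d, LipschitzOnWith ⟨P + R, add_nonneg hP0 hR0⟩ (F t) Set.univ := by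
    intro t ht
    refine LipschitzOnWith.of_dist_le_mul fun x _ y _ ↦ ?_
    have h1 : F t x - F t y = (p t * (x - y).1 + q t * conj (x - y).2,
        p t * (x - y).2 + q t * conj (x - y).1) := by
      ext1 <;> simp [F] <;> ring
    rw [dist_eq_norm, dist_eq_norm, h1]
    exact norm_prod_le_iff.2
      ⟨hbound t ht _ _ _ (norm_fst_le _) (norm_snd_le _),
        hbound t ht _ _ _ (norm_snd_le _) (norm_fst_le _)⟩
  have key := ODE_solution_unique_of_mem_Ioo (f := fun t ↦ (u t, v t)) (g := fun _ ↦ 0) hF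
    ⟨hc0, hd0⟩
    (fun t ht ↦ ⟨(hu t (hsub (Set.Ioo_subset_Icc_self ht))).prodMk
      (hv t (hsub (Set.Ioo_subset_Icc_self ht))), Set.mem_univ _⟩)
    (fun t _ ↦ ⟨by simpa [F, Prod.mk_zero_zero] using hasDerivAt_const t (0 : ℂ × ℂ), Set.mem_univ _⟩)
    (by simp [hu0, hv0])
  exact Prod.mk_eq_zero.1 (key ⟨hcr, hrd⟩)

/-- Integration of the Sachs equations: if ρ, σ solve dρ/dr = ρ² + σconj(σ),
dσ/dr = (ρ + conj(ρ))σ on an open interval containing 0, with initial values ρ₀, σ₀,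
then ρ(r) = (ρ₀ − (ρ₀conj(ρ₀) − σ₀conj(σ₀))r)/Q(r) and σ(r) = σ₀/Q(r), where
Q(r) = 1 − (ρ₀ + conj(ρ₀))r + (ρ₀conj(ρ₀) − σ₀conj(σ₀))r², as long as Q does not
vanish between 0 and r. -/
theorem sachs_integration (a b : ℝ) (ha : a < 0) (hb : 0 < b)
    (ρ σ : ℝ → ℂ) (ρ₀ σ₀ : ℂ)
    (hρ0 : ρ 0 = ρ₀) (hσ0 : σ 0 = σ₀)
    (hρ : ∀ r ∈ Set.Ioo a b, HasDerivAt ρ (ρ r ^ 2 + σ r * conj (σ r)) r)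
    (hσ : ∀ r ∈ Set.Ioo a b, HasDerivAt σ ((ρ r + conj (ρ r)) * σ r) r) :
    ∀ r ∈ Set.Ioo a b,
      (∀ s ∈ Set.uIcc (0 : ℝ) r,
          (1 : ℂ) - (ρ₀ + conj ρ₀) * s + (ρ₀ * conj ρ₀ - σ₀ * conj σ₀) * s ^ 2 ≠ 0) →
      ρ r = (ρ₀ - (ρ₀ * conj ρ₀ - σ₀ * conj σ₀) * r) /
              (1 - (ρ₀ + conj ρ₀) * r + (ρ₀ * conj ρ₀ - σ₀ * conj σ₀) * r ^ 2) ∧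
      σ r = σ₀ / (1 - (ρ₀ + conj ρ₀) * r + (ρ₀ * conj ρ₀ - σ₀ * conj σ₀) * r ^ 2) := by
  intro r hr hQ
  have hρc : ContinuousOn ρ (Set.Ioo a b) := fun t ht ↦ (hρ t ht).continuousAt.continuousWithinAt
  have hσc : ContinuousOn σ (Set.Ioo a b) := fun t ht ↦ (hσ t ht).continuousAt.continuousWithinAt
  have hid : ∀ t : ℝ, HasDerivAt (fun s : ℝ ↦ (s : ℂ)) 1 t := fun t ↦ (hasDerivAt_id t).ofReal_comp
  obtain ⟨h1, h2⟩ := eq_zero_of_linear_conj_system ha hb hρc hσc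
    (u := fun t ↦ ρ t * (1 - t * ρ₀) - σ t * (t * conj σ₀) - ρ₀)
    (v := fun t ↦ σ t * (1 - t * conj ρ₀) - ρ t * (t * σ₀) - σ₀)
    (fun t ht ↦ by
      refine HasDerivAt.congr_deriv ((((hρ t ht).mul (((hid t).mul_const ρ₀).const_sub 1)).sub
        ((hσ t ht).mul ((hid t).mul_const (conj σ₀)))).sub_const ρ₀) ?_
      simp only [map_sub, map_mul, map_one, conj_ofReal, conj_conj]
      ring)
    (fun t ht ↦ by
      refine HasDerivAt.congr_deriv ((((hσ t ht).mul (((hid t).mul_const (conj ρ₀)).const_sub 1)).sub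
        ((hρ t ht).mul ((hid t).mul_const σ₀))).sub_const σ₀) ?_
      simp only [map_sub, map_mul, map_one, conj_ofReal, conj_conj]
      ring)
    (by simp [hρ0]) (by simp [hσ0]) hr
  have hQr := hQ r Set.right_mem_uIcc
  rw [eq_div_iff hQr, eq_div_iff hQr]
  constructor
  · linear_combination (1 - r * conj ρ₀) * h1 + r * conj σ₀ * h2
  · linear_combination r * σ₀ * h1 + (1 - r * ρ₀) * h2
end

section
/- Let I ⊆ ℝ be an interval containing r₀ and let ρ, σ : I → ℂ be differentiable functions satisfying dρ/dr = ρ² + σ·conj(σ) and dσ/dr = (ρ + conj(ρ))·σ on I. Then: (i) if σ(r₀) = 0 then σ(r) = 0 for all r ∈ I; (ii) if Im ρ(r₀) = 0 then Im ρ(r) = 0 for all r ∈ I. That is, if the shear or the twist of a line congruence vanishes at some point of a line, it vanishes at every point of that line. -/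
open Complex
open scoped ComplexConjugate

/-- A solution of the linear equation `f' = a • f` on `[s, t]` that vanishes at `s` vanishes on
`[s, t]`. -/
theorem eq_zero_of_hasDerivWithinAt_smul_Icc {E : Type*} [NormedAddCommGroup E] [NormedSpace ℝ E]
    {a : ℝ → ℝ} {f : ℝ → E} {s t : ℝ} (ha : ContinuousOn a (Set.Icc s t))
    (hf : ∀ r ∈ Set.Icc s t, HasDerivWithinAt f (a r • f r) (Set.Icc s t) r) (hs : f s = 0) :
    ∀ r ∈ Set.Icc s t, f r = 0 := by
  obtain ⟨K, hK⟩ := isCompact_Icc.exists_bound_of_continuousOn ha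
  refine eq_zero_of_abs_deriv_le_mul_abs_self_of_eq_zero_right (K := K)
    (fun r hr => (hf r hr).continuousWithinAt)
    (fun r hr => (hf r (Set.Ico_subset_Icc_self hr)).mono_of_mem_nhdsWithin
      (Icc_mem_nhdsGE_of_mem hr)) hs (fun r hr => ?_)
  rw [norm_smul]
  exact mul_le_mul_of_nonneg_right (hK r (Set.Ico_subset_Icc_self hr)) (norm_nonneg _)

/-- A solution of the linear equation `f' = a • f` on a convex set that vanishes at one point
vanishes identically. -/
theorem eq_zero_of_hasDerivWithinAt_smul {E : Type*} [NormedAddCommGroup E] [NormedSpace ℝ E]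
    {I : Set ℝ} (hI : Convex ℝ I) {a : ℝ → ℝ} {f : ℝ → E} {r₀ : ℝ} (hr₀ : r₀ ∈ I)
    (ha : ContinuousOn a I) (hf : ∀ r ∈ I, HasDerivWithinAt f (a r • f r) I r) (h₀ : f r₀ = 0) :
    ∀ r ∈ I, f r = 0 := by
  intro r hr
  rcases le_total r₀ r with h | h
  · have hsub : Set.Icc r₀ r ⊆ I := hI.ordConnected.out hr₀ hr
    exact eq_zero_of_hasDerivWithinAt_smul_Icc (ha.mono hsub)
      (fun x hx => (hf x (hsub hx)).mono hsub) h₀ r (Set.right_mem_Icc.2 h)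
  · have hmaps : Set.MapsTo (fun x : ℝ => -x) (Set.Icc (-r₀) (-r)) I := fun x hx =>
      hI.ordConnected.out hr hr₀ ⟨le_neg_of_le_neg hx.2, neg_le.1 hx.1⟩
    have := eq_zero_of_hasDerivWithinAt_smul_Icc (a := fun x => -a (-x)) (f := fun x => f (-x))
      (s := -r₀) (t := -r) (ha.comp continuous_neg.continuousOn hmaps).neg
      (fun x hx => by
        simpa [Function.comp_def] using (hf (-x) (hmaps hx)).scomp x
          (hasDerivAt_neg x).hasDerivWithinAt hmaps)
      (by simpa using h₀) (-r) (Set.right_mem_Icc.2 (neg_le_neg h))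
    simpa using this

/-- If the shear or the twist of a line congruence vanishes at some point of a line,
it vanishes at every point of that line: for solutions of the Sachs equations on an
interval I ∋ r₀, σ(r₀) = 0 implies σ ≡ 0 on I, and Im ρ(r₀) = 0 implies Im ρ ≡ 0 on I.
(An interval of ℝ is a convex subset.) -/
theorem shear_and_twist_propagate (I : Set ℝ) (hI : Convex ℝ I) (r₀ : ℝ) (hr₀ : r₀ ∈ I)
    (ρ σ : ℝ → ℂ)
    (hρ : ∀ r ∈ I, HasDerivWithinAt ρ (ρ r ^ 2 + σ r * conj (σ r)) I r)
    (hσ : ∀ r ∈ I, HasDerivWithinAt σ ((ρ r + conj (ρ r)) * σ r) I r) :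
    (σ r₀ = 0 → ∀ r ∈ I, σ r = 0) ∧
    ((ρ r₀).im = 0 → ∀ r ∈ I, (ρ r).im = 0) := by
  have ha : ContinuousOn (fun r => 2 * (ρ r).re) I :=
    continuousOn_const.mul (continuous_re.comp_continuousOn fun r hr => (hρ r hr).continuousWithinAt)
  refine ⟨eq_zero_of_hasDerivWithinAt_smul hI hr₀ ha fun r hr => ?_,
    eq_zero_of_hasDerivWithinAt_smul (f := fun r => (ρ r).im) hI hr₀ ha fun r hr => ?_⟩
  · simpa [add_conj] using hσ r hr
  · have h := imCLM.hasFDerivAt.comp_hasDerivWithinAt r (hρ r hr)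
    refine h.congr_deriv ?_
    simp [pow_two, mul_conj]
    ring
end

section
/- Let F, ξ : ℝ² → ℂ be C¹, r ∈ ℝ, and p ∈ ℝ² a point at which D = ∂⁻F·conj(∂⁻F) − ∂⁺F·conj(∂⁺F) ≠ 0. Define the curvature K = ρ·conj(ρ) − σ·conj(σ) with ρ = (∂⁺F·conj(∂ξ) − ∂⁻F·conj(∂̄ξ))/D and σ = (conj(∂⁺F)·conj(∂̄ξ) − conj(∂⁻F)·conj(∂ξ))/D. Then K(p) ≠ 0 if and only if the map (u,v) ↦ ξ(u,v), regarded as a map ℝ² → ℝ², has nonzero Jacobian determinant at p, i.e. is a local diffeomorphism at p. In particular, if K(p) ≠ 0 there exist an open neighbourhood U of p, an open set V ⊆ ℂ, and a C¹ map G : V → ℂ such that ξ restricted to U is a diffeomorphism onto V and F = G ∘ ξ on U; that is, the congruence is locally the graph of a section of the bundle T ℙ¹ → ℙ¹. -/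
open Complex
open scoped ComplexConjugate

/-- D = ∂⁻F·conj(∂⁻F) − ∂⁺F·conj(∂⁺F). -/
noncomputable def Dq (F ξ : ℝ × ℝ → ℂ) (r : ℝ) (p : ℝ × ℝ) : ℂ :=
  dminus F ξ r p * conj (dminus F ξ r p) - dplus F ξ r p * conj (dplus F ξ r p)

/-- ρ = (∂⁺F·conj(∂ξ) − ∂⁻F·conj(∂̄ξ))/D, the complex divergence/twist. -/
noncomputable def rhoC (F ξ : ℝ × ℝ → ℂ) (r : ℝ) (p : ℝ × ℝ) : ℂ :=
  (dplus F ξ r p * conj (wd ξ p) - dminus F ξ r p * conj (wdb ξ p)) / Dq F ξ r p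

/-- σ = (conj(∂⁺F)·conj(∂̄ξ) − conj(∂⁻F)·conj(∂ξ))/D, the shear. -/
noncomputable def sigmaC (F ξ : ℝ × ℝ → ℂ) (r : ℝ) (p : ℝ × ℝ) : ℂ :=
  (conj (dplus F ξ r p) * conj (wdb ξ p) - conj (dminus F ξ r p) * conj (wd ξ p)) /
    Dq F ξ r p

/-- The curvature K of the congruence. -/
noncomputable def Kc (F ξ : ℝ × ℝ → ℂ) (r : ℝ) (p : ℝ × ℝ) : ℂ :=
  rhoC F ξ r p * conj (rhoC F ξ r p) - sigmaC F ξ r p * conj (sigmaC F ξ r p)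

/-- A complex-valued real derivative in terms of the Wirtinger derivatives. -/
theorem fderiv_apply_eq_wd_add_wdb (f : ℝ × ℝ → ℂ) (p v : ℝ × ℝ) :
    fderiv ℝ f p v = wd f p * (v.1 + v.2 * I) + wdb f p * (v.1 - v.2 * I) := by
  have hv : v = v.1 • ((1, 0) : ℝ × ℝ) + v.2 • ((0, 1) : ℝ × ℝ) := by
    ext <;> simp
  conv_lhs => rw [hv]
  rw [map_add, map_smul, map_smul, wd, wdb, real_smul, real_smul]
  linear_combination (v.2 * fderiv ℝ f p (0, 1)) * I_sq

theorem injective_fderiv_of_wd (f : ℝ × ℝ → ℂ) (p : ℝ × ℝ)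
    (h : wd f p * conj (wd f p) - wdb f p * conj (wdb f p) ≠ 0) :
    Function.Injective (fderiv ℝ f p) := by
  rw [injective_iff_map_eq_zero]
  intro v hv
  rw [fderiv_apply_eq_wd_add_wdb] at hv
  have hv' := congrArg conj hv
  simp only [map_add, map_sub, map_mul, conj_ofReal, conj_I, map_zero] at hv'
  have hz : (v.1 + v.2 * I : ℂ) = 0 := by
    refine (mul_eq_zero.mp (?_ : (wd f p * conj (wd f p) - wdb f p * conj (wdb f p)) *
      (v.1 + v.2 * I : ℂ) = 0)).resolve_left h
    linear_combination conj (wd f p) * hv - wdb f p * hv'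
  have hre := congrArg re hz
  have him := congrArg im hz
  simp at hre him
  exact Prod.ext hre him

/-- The curvature is `-J / D`, with `J` the Jacobian determinant of `ξ`. -/
theorem Kc_eq_neg_div (F ξ : ℝ × ℝ → ℂ) (r : ℝ) (p : ℝ × ℝ) :
    Kc F ξ r p = -(wd ξ p * conj (wd ξ p) - wdb ξ p * conj (wdb ξ p)) / Dq F ξ r p := by
  have hc : conj (Dq F ξ r p) = Dq F ξ r p := by
    simp only [Dq, map_sub, map_mul, conj_conj]
    ring
  by_cases hD : Dq F ξ r p = 0
  · simp [Kc, rhoC, sigmaC, hD]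
  rw [Kc, rhoC, sigmaC, map_div₀, map_div₀, hc]
  field_simp
  simp only [Dq, map_sub, map_mul, conj_conj]
  ring

/-- The inverse function theorem on a neighbourhood where the inverse is `C¹`. -/
theorem exists_local_inverse_of_injective_fderiv {E E' : Type*}
    [NormedAddCommGroup E] [NormedSpace ℝ E] [FiniteDimensional ℝ E]
    [NormedAddCommGroup E'] [NormedSpace ℝ E'] [FiniteDimensional ℝ E']
    (hdim : Module.finrank ℝ E = Module.finrank ℝ E') {f : E → E'} {p : E}
    (hf : ContDiffAt ℝ 1 f p) (hinj : Function.Injective (fderiv ℝ f p)) :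
    ∃ e : OpenPartialHomeomorph E E', p ∈ e.source ∧ ⇑e = f ∧
      ContDiffOn ℝ 1 e.symm e.target := by
  have := FiniteDimensional.complete ℝ E
  let L : E ≃L[ℝ] E' :=
    (LinearEquiv.ofInjectiveOfFinrankEq
      (fderiv ℝ f p : E →ₗ[ℝ] E') hinj hdim).toContinuousLinearEquiv
  have hL : HasFDerivAt f (L : E →L[ℝ] E') p := by
    convert (hf.differentiableAt one_ne_zero).hasFDerivAt using 1
    ext v
    rfl
  have hcd : ContDiffAt ℝ 1 (hf.toOpenPartialHomeomorph f hL one_ne_zero).symm (f p) :=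
    hf.to_localInverse hL one_ne_zero
  obtain ⟨W, hW, hWo, hpW⟩ := eventually_nhds_iff.mp (hcd.eventually (by simp))
  let e := hf.toOpenPartialHomeomorph f hL one_ne_zero
  refine ⟨(e.symm.restrOpen W hWo).symm, ?_, rfl, fun y hy => (hW y ?_).contDiffWithinAt⟩
  · exact ⟨hf.mem_toOpenPartialHomeomorph_source hL one_ne_zero, hpW⟩
  · exact hy.2

/-- K(p) ≠ 0 iff the Jacobian determinant ∂ξ·conj(∂ξ) − ∂̄ξ·conj(∂̄ξ) of (u,v) ↦ ξ is
nonzero at p; and in that case the congruence is locally the graph of a section of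
T ℙ¹ → ℙ¹: ξ restricts to a C¹ diffeomorphism of a neighbourhood U of p onto an open
set V ⊆ ℂ and F = G ∘ ξ on U for a C¹ map G : V → ℂ. -/
theorem curvature_nonzero_iff_local_section
    (F ξ : ℝ × ℝ → ℂ) (hF : ContDiff ℝ 1 F) (hξ : ContDiff ℝ 1 ξ)
    (r : ℝ) (p : ℝ × ℝ) (hD : Dq F ξ r p ≠ 0) :
    (Kc F ξ r p ≠ 0 ↔ wd ξ p * conj (wd ξ p) - wdb ξ p * conj (wdb ξ p) ≠ 0) ∧
    (Kc F ξ r p ≠ 0 →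
      ∃ (U : Set (ℝ × ℝ)) (V : Set ℂ) (G : ℂ → ℂ) (H : ℂ → ℝ × ℝ),
        IsOpen U ∧ p ∈ U ∧ IsOpen V ∧
        Set.InjOn ξ U ∧ ξ '' U = V ∧
        ContDiffOn ℝ 1 H V ∧ (∀ q ∈ U, H (ξ q) = q) ∧
        ContDiffOn ℝ 1 G V ∧ (∀ q ∈ U, F q = G (ξ q))) := by
  have hiff : Kc F ξ r p ≠ 0 ↔
      wd ξ p * conj (wd ξ p) - wdb ξ p * conj (wdb ξ p) ≠ 0 := by
    rw [Kc_eq_neg_div, div_ne_zero_iff, neg_ne_zero]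
    exact and_iff_left hD
  refine ⟨hiff, fun hK => ?_⟩
  obtain ⟨e, hp, rfl, he⟩ := exists_local_inverse_of_injective_fderiv
    (by simp [Complex.finrank_real_complex]) hξ.contDiffAt
    (injective_fderiv_of_wd ξ p (hiff.mp hK))
  exact ⟨e.source, e.target, F ∘ e.symm, e.symm, e.open_source, hp, e.open_target, e.injOn,
    e.image_source_eq_target, he, fun q hq => e.left_inv hq, hF.comp_contDiffOn he,
    fun q hq => congrArg F (e.left_inv hq).symm⟩
end

section
/- Let F, ξ : ℝ² → ℂ be C¹ and let r : ℝ² → ℝ be C¹. Define the surface S : ℝ² → ℝ³ by S(u,v) = Φ(u,v,r(u,v)), where Φ is the congruence coordinate map. Then at a point (u,v), both partial derivatives ∂S/∂u and ∂S/∂v are orthogonal (for the Euclidean inner product) to the direction vector W(ξ(u,v)) if and only if ∂̄r = (2F·conj(∂ξ) + 2·conj(F)·∂̄ξ)/(1+ξ·conj(ξ))² at (u,v). Equivalently, a parametric surface obtained by choosing r = r(u,v) is orthogonal to an integrable line congruence exactly when r satisfies this first-order PDE. -/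
open Complex
open scoped ComplexConjugate

/-- z = (2(F − conj(F)ξ²) + 2ξ(1+ξconj(ξ))r)/(1+ξconj(ξ))². -/
noncomputable def zC (F ξ : ℝ × ℝ → ℂ) (p : ℝ × ℝ) (r : ℝ) : ℂ :=
  (2 * (F p - conj (F p) * (ξ p) ^ 2) + 2 * ξ p * (1 + ξ p * conj (ξ p)) * r) /
    (1 + ξ p * conj (ξ p)) ^ 2

/-- t = (−2(F·conj(ξ) + conj(F)·ξ) + (1 − ξ²conj(ξ)²)r)/(1+ξconj(ξ))². -/
noncomputable def tC (F ξ : ℝ × ℝ → ℂ) (p : ℝ × ℝ) (r : ℝ) : ℂ :=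
  (-2 * (F p * conj (ξ p) + conj (F p) * ξ p) + (1 - (ξ p) ^ 2 * (conj (ξ p)) ^ 2) * r) /
    (1 + ξ p * conj (ξ p)) ^ 2

/-- The congruence coordinate map Φ : (u,v,r) ↦ (Re z, Im z, t). -/
noncomputable def Phi (F ξ : ℝ × ℝ → ℂ) (w : ℝ × ℝ × ℝ) : ℝ × ℝ × ℝ :=
  ((zC F ξ (w.1, w.2.1) w.2.2).re, (zC F ξ (w.1, w.2.1) w.2.2).im,
    (tC F ξ (w.1, w.2.1) w.2.2).re)

/-- The (real) unit direction vector W(ξ) ∈ ℝ³ of the line labelled by ξ. -/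
noncomputable def Wr (ξ : ℂ) : ℝ × ℝ × ℝ :=
  (((ξ + conj ξ) / (1 + ξ * conj ξ)).re,
   (-Complex.I * (ξ - conj ξ) / (1 + ξ * conj ξ)).re,
   ((1 - ξ * conj ξ) / (1 + ξ * conj ξ)).re)

/-- The Euclidean inner product on ℝ³ = ℝ × ℝ × ℝ. -/
def dot3 (a b : ℝ × ℝ × ℝ) : ℝ := a.1 * b.1 + a.2.1 * b.2.1 + a.2.2 * b.2.2

/-- The congruence map in real coordinates, with `ξ = a + ib` and `F = f + ig`. -/
noncomputable def congruencePoint (a b f g r : ℝ) : ℝ × ℝ × ℝ :=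
  ((2 * (f - (f * (a ^ 2 - b ^ 2) + 2 * g * a * b)) + 2 * a * (1 + (a ^ 2 + b ^ 2)) * r) /
      (1 + (a ^ 2 + b ^ 2)) ^ 2,
   (2 * (g - (2 * f * a * b - g * (a ^ 2 - b ^ 2))) + 2 * b * (1 + (a ^ 2 + b ^ 2)) * r) /
      (1 + (a ^ 2 + b ^ 2)) ^ 2,
   (-4 * (f * a + g * b) + (1 - (a ^ 2 + b ^ 2) ^ 2) * r) / (1 + (a ^ 2 + b ^ 2)) ^ 2)

lemma one_add_mul_conj (z : ℂ) :
    1 + z * conj z = ((1 + (z.re ^ 2 + z.im ^ 2) : ℝ) : ℂ) := by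
  rw [mul_conj, normSq_apply]
  push_cast
  ring

lemma Phi_eq_congruencePoint (F ξ : ℝ × ℝ → ℂ) (q : ℝ × ℝ) (r : ℝ) :
    Phi F ξ (q.1, q.2, r) =
      congruencePoint (ξ q).re (ξ q).im (F q).re (F q).im r := by
  simp only [Phi, zC, tC, congruencePoint, Prod.mk.eta, one_add_mul_conj, ← ofReal_pow,
    div_ofReal_re, div_ofReal_im]
  refine Prod.ext ?_ (Prod.ext ?_ ?_) <;> dsimp only <;> congr 1 <;>
    simp [pow_two] <;> ring

lemma Wr_eq (z : ℂ) :
    Wr z = (2 * z.re / (1 + (z.re ^ 2 + z.im ^ 2)), 2 * z.im / (1 + (z.re ^ 2 + z.im ^ 2)),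
      (1 - (z.re ^ 2 + z.im ^ 2)) / (1 + (z.re ^ 2 + z.im ^ 2))) := by
  simp only [Wr, one_add_mul_conj, div_ofReal_re]
  refine Prod.ext ?_ (Prod.ext ?_ ?_) <;> dsimp only <;> congr 1 <;>
    simp [pow_two] <;> ring

lemma exists_hasDerivAt_congruencePoint {a b f g r : ℝ → ℝ} {a' b' f' g' r' t : ℝ}
    (ha : HasDerivAt a a' t) (hb : HasDerivAt b b' t) (hf : HasDerivAt f f' t)
    (hg : HasDerivAt g g' t) (hr : HasDerivAt r r' t) :
    ∃ w, HasDerivAt (fun s => congruencePoint (a s) (b s) (f s) (g s) (r s)) w t ∧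
      dot3 w (2 * a t / (1 + (a t ^ 2 + b t ^ 2)), 2 * b t / (1 + (a t ^ 2 + b t ^ 2)),
        (1 - (a t ^ 2 + b t ^ 2)) / (1 + (a t ^ 2 + b t ^ 2))) =
      r' - 4 * (f t * a' + g t * b') / (1 + (a t ^ 2 + b t ^ 2)) ^ 2 := by
  have hn : 1 + (a t ^ 2 + b t ^ 2) ≠ 0 := by positivity
  have ha2 := ha.fun_pow 2
  have hb2 := hb.fun_pow 2
  have hm := ha2.fun_add hb2
  have hD := hm.const_add 1
  have hD2 := hD.fun_pow 2
  have hD0 : (1 + (a t ^ 2 + b t ^ 2)) ^ 2 ≠ 0 := pow_ne_zero 2 hn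
  have hx := ((((hf.fun_sub ((hf.fun_mul (ha2.fun_sub hb2)).fun_add
    (((hg.const_mul 2).fun_mul ha).fun_mul hb))).const_mul 2).fun_add
    (((ha.const_mul 2).fun_mul hD).fun_mul hr)).fun_div hD2 hD0)
  have hy := ((((hg.fun_sub ((((hf.const_mul 2).fun_mul ha).fun_mul hb).fun_sub
    (hg.fun_mul (ha2.fun_sub hb2)))).const_mul 2).fun_add
    (((hb.const_mul 2).fun_mul hD).fun_mul hr)).fun_div hD2 hD0)
  have hz := ((((hf.fun_mul ha).fun_add (hg.fun_mul hb)).const_mul (-4)).fun_add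
    (((hm.fun_pow 2).const_sub 1).fun_mul hr)).fun_div hD2 hD0
  refine ⟨_, hx.prodMk (hy.prodMk hz), ?_⟩
  simp only [dot3]
  field_simp
  ring

lemma dot3_fderiv_Phi {F ξ : ℝ × ℝ → ℂ} {rf : ℝ × ℝ → ℝ} {p : ℝ × ℝ}
    (hF : DifferentiableAt ℝ F p) (hξ : DifferentiableAt ℝ ξ p)
    (hr : DifferentiableAt ℝ rf p) (v : ℝ × ℝ) :
    dot3 (fderiv ℝ (fun q : ℝ × ℝ => Phi F ξ (q.1, q.2, rf q)) p v) (Wr (ξ p)) =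
      fderiv ℝ rf p v -
        4 * ((F p).re * (fderiv ℝ ξ p v).re + (F p).im * (fderiv ℝ ξ p v).im) /
          (1 + ((ξ p).re ^ 2 + (ξ p).im ^ 2)) ^ 2 := by
  simp only [Phi_eq_congruencePoint]
  have hline : HasDerivAt (fun s : ℝ => p + s • v) v 0 := by
    simpa using ((hasDerivAt_id (0 : ℝ)).smul_const v).const_add p
  have hp : p = p + (0 : ℝ) • v := by simp
  have hFre : DifferentiableAt ℝ (fun q => (F q).re) p := reCLM.differentiableAt.comp p hF
  have hFim : DifferentiableAt ℝ (fun q => (F q).im) p := imCLM.differentiableAt.comp p hF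
  have hξre : DifferentiableAt ℝ (fun q => (ξ q).re) p := reCLM.differentiableAt.comp p hξ
  have hξim : DifferentiableAt ℝ (fun q => (ξ q).im) p := imCLM.differentiableAt.comp p hξ
  have hS : DifferentiableAt ℝ (fun q =>
      congruencePoint (ξ q).re (ξ q).im (F q).re (F q).im (rf q)) p := by
    have hD : (1 + ((ξ p).re ^ 2 + (ξ p).im ^ 2)) ^ 2 ≠ 0 := by positivity
    unfold congruencePoint
    fun_prop (disch := exact hD)
  have along {E : Type} [NormedAddCommGroup E] [NormedSpace ℝ E] {G : ℝ × ℝ → E}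
      (hG : DifferentiableAt ℝ G p) :
      HasDerivAt (fun s : ℝ => G (p + s • v)) (fderiv ℝ G p v) 0 :=
    hG.hasFDerivAt.comp_hasDerivAt_of_eq 0 hline hp
  obtain ⟨w, hw, hdot⟩ := exists_hasDerivAt_congruencePoint
    (reCLM.hasFDerivAt.comp_hasDerivAt 0 (along hξ))
    (imCLM.hasFDerivAt.comp_hasDerivAt 0 (along hξ))
    (along hFre) (along hFim) (along hr)
  have hwS := (along hS).unique hw
  rw [hwS, Wr_eq]
  simpa using hdot

lemma wdb_ofReal {rf : ℝ × ℝ → ℝ} {p : ℝ × ℝ} (hr : DifferentiableAt ℝ rf p) :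
    wdb (fun q => (rf q : ℂ)) p =
      (1 / 2) * (fderiv ℝ rf p (1, 0) + I * fderiv ℝ rf p (0, 1)) := by
  have h : HasFDerivAt (fun q => (rf q : ℂ)) (ofRealCLM.comp (fderiv ℝ rf p)) p :=
    ofRealCLM.hasFDerivAt.comp p hr.hasFDerivAt
  simp [wdb, h.fderiv]

/-- The surface S(u,v) = Φ(u,v,r(u,v)) is orthogonal to the lines of the congruence
(i.e. ∂S/∂u ⊥ W and ∂S/∂v ⊥ W) exactly when
∂̄r = (2F·conj(∂ξ) + 2conj(F)·∂̄ξ)/(1+ξconj(ξ))². -/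
theorem orthogonal_surface_condition
    (F ξ : ℝ × ℝ → ℂ) (rf : ℝ × ℝ → ℝ)
    (hF : ContDiff ℝ 1 F) (hξ : ContDiff ℝ 1 ξ) (hr : ContDiff ℝ 1 rf)
    (p : ℝ × ℝ) :
    let S : ℝ × ℝ → ℝ × ℝ × ℝ := fun q => Phi F ξ (q.1, q.2, rf q)
    (dot3 (fderiv ℝ S p (1, 0)) (Wr (ξ p)) = 0 ∧
     dot3 (fderiv ℝ S p (0, 1)) (Wr (ξ p)) = 0) ↔
    wdb (fun q => (rf q : ℂ)) p =
      (2 * F p * conj (wd ξ p) + 2 * conj (F p) * wdb ξ p) /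
        (1 + ξ p * conj (ξ p)) ^ 2 := by
  intro S
  have hF' := hF.differentiable one_ne_zero p
  have hξ' := hξ.differentiable one_ne_zero p
  have hr' := hr.differentiable one_ne_zero p
  rw [dot3_fderiv_Phi hF' hξ' hr', dot3_fderiv_Phi hF' hξ' hr', wdb_ofReal hr',
    one_add_mul_conj, ← ofReal_pow, Complex.ext_iff, div_ofReal_re, div_ofReal_im]
  simp only [wd, wdb, sub_eq_zero]
  generalize fderiv ℝ ξ p (1, 0) = ξu
  generalize fderiv ℝ ξ p (0, 1) = ξv
  have hn : 1 + ((ξ p).re ^ 2 + (ξ p).im ^ 2) ≠ 0 := by positivity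
  simp
  field_simp
  ring_nf
end

section
/- Let U : S² → ℝ³ be a continuous tangent vector field on the unit sphere S² ⊂ ℝ³, i.e. ⟨U(W), W⟩ = 0 for every W ∈ S². Then for every point p ∈ ℝ³ there exist W ∈ S² and r ∈ ℝ such that p = U(W) + r·W. That is, every point of ℝ³ lies on some line of a globally convex congruence: such congruences are spacefilling. -/
open scoped RealInnerProductSpace

/-- A continuous nowhere vanishing function on the plane has a continuous logarithm. -/
lemma exists_continuous_log {H : ℝ × ℝ → ℂ} (hH : Continuous H) (h0 : ∀ x, H x ≠ 0) :
    ∃ L : ℝ × ℝ → ℂ, Continuous L ∧ ∀ x, Complex.exp (L x) = H x := by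
  obtain ⟨F, ⟨-, hF⟩, -⟩ := Complex.isCoveringMapOn_exp.existsUnique_continuousMap_lifts
    (⟨H, hH⟩ : C(ℝ × ℝ, ℂ)) (a₀ := 0) (Complex.exp_log (h0 0)) h0
  exact ⟨F, F.continuous, congr_fun hF⟩

/-- Two continuous complex functions on a preconnected space with equal exponentials
differ by a constant. -/
lemma sub_eq_sub_of_exp_eq {X : Type*} [TopologicalSpace X] [PreconnectedSpace X] {f g : X → ℂ}
    (hf : Continuous f) (hg : Continuous g) (h : ∀ x, Complex.exp (f x) = Complex.exp (g x))
    (x y : X) : f x - g x = f y - g y := by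
  have hcov := Complex.isCoveringMapOn_exp.isCoveringMap_restrictPreimage
  exact congr_arg Subtype.val <| hcov.const_of_comp (A := X)
    (g := fun t ↦ ⟨f t - g t, Complex.exp_ne_zero _⟩) (by fun_prop)
    (fun s t ↦ by ext; simp [Complex.exp_sub, h]) x y

/-- Winding numbers are homotopy invariant: a nowhere vanishing continuous function that is
`2π`-periodic in its first variable cannot interpolate between clockwise and counterclockwise
rotation. -/
lemma not_exists_homotopy_exp_neg {H : ℝ × ℝ → ℂ} (hH : Continuous H) (h0 : ∀ x, H x ≠ 0)
    (hper : ∀ θ φ, H (θ + 2 * Real.pi, φ) = H (θ, φ)) {a b : ℝ} {c d : ℂ}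
    (ha : ∀ θ : ℝ, H (θ, a) = c * Complex.exp (-(θ * Complex.I)))
    (hb : ∀ θ : ℝ, H (θ, b) = d * Complex.exp (θ * Complex.I)) : False := by
  obtain ⟨L, hL, hexp⟩ := exists_continuous_log hH h0
  have hc : Complex.exp (L (0, a)) = c := by simp [hexp, ha]
  have hd : Complex.exp (L (0, b)) = d := by simp [hexp, hb]
  have hA := sub_eq_sub_of_exp_eq (X := ℝ) (f := fun θ ↦ L (θ, a))
    (g := fun θ ↦ L (0, a) + -(θ * Complex.I)) (by fun_prop) (by fun_prop)
    (fun θ ↦ by rw [Complex.exp_add, hexp, hc, ha]) (2 * Real.pi) 0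
  have hB := sub_eq_sub_of_exp_eq (X := ℝ) (f := fun θ ↦ L (θ, b))
    (g := fun θ ↦ L (0, b) + θ * Complex.I) (by fun_prop) (by fun_prop)
    (fun θ ↦ by rw [Complex.exp_add, hexp, hd, hb]) (2 * Real.pi) 0
  have hP := sub_eq_sub_of_exp_eq (X := ℝ) (f := fun φ ↦ L (0 + 2 * Real.pi, φ))
    (g := fun φ ↦ L (0, φ)) (by fun_prop) (by fun_prop)
    (fun φ ↦ by rw [hexp, hexp, hper]) a b
  have hI : (4 * Real.pi : ℂ) * Complex.I = 0 := by
    simp only [zero_add, Complex.ofReal_mul, Complex.ofReal_ofNat, Complex.ofReal_zero,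
      zero_mul, neg_zero, add_zero] at hA hB hP
    linear_combination hA - hB - hP
  simp [Real.pi_ne_zero] at hI

/-- The point of the unit sphere with longitude `θ` and latitude `φ`. -/
noncomputable def spherePoint (x : ℝ × ℝ) : EuclideanSpace ℝ (Fin 3) :=
  !₂[Real.cos x.2 * Real.cos x.1, Real.cos x.2 * Real.sin x.1, Real.sin x.2]

lemma continuous_spherePoint : Continuous spherePoint := by
  refine (PiLp.continuous_toLp 2 _).comp (continuous_pi fun i ↦ ?_)
  fin_cases i <;> simp <;> fun_prop

lemma spherePoint_mem_sphere (x : ℝ × ℝ) :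
    spherePoint x ∈ Metric.sphere (0 : EuclideanSpace ℝ (Fin 3)) 1 := by
  rw [mem_sphere_zero_iff_norm, EuclideanSpace.norm_eq, Real.sqrt_eq_one]
  simp only [spherePoint, Fin.sum_univ_three, Real.norm_eq_abs, sq_abs]
  simp
  linear_combination
    Real.cos x.2 ^ 2 * Real.sin_sq_add_cos_sq x.1 + Real.sin_sq_add_cos_sq x.2

/-- The east and north components of the vector `v`, in the orthonormal frame of the tangent plane
at longitude `θ` and latitude `φ`, as a complex number. -/
noncomputable def tangentComponent (v : EuclideanSpace ℝ (Fin 3)) (x : ℝ × ℝ) : ℂ :=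
  ⟨-(v 0 * Real.sin x.1) + v 1 * Real.cos x.1,
    -(Real.sin x.2 * (v 0 * Real.cos x.1 + v 1 * Real.sin x.1)) + v 2 * Real.cos x.2⟩

lemma continuous_tangentComponent {v : ℝ × ℝ → EuclideanSpace ℝ (Fin 3)} (hv : Continuous v) :
    Continuous fun x ↦ tangentComponent (v x) x := by
  have hcoord (i : Fin 3) : Continuous fun x ↦ v x i :=
    (EuclideanSpace.proj (𝕜 := ℝ) i).continuous.comp hv
  have h₀ := hcoord 0
  have h₁ := hcoord 1
  have h₂ := hcoord 2
  simp only [tangentComponent, Complex.mk_eq_add_mul_I]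
  fun_prop

lemma exists_eq_smul_of_tangentComponent_eq_zero {v : EuclideanSpace ℝ (Fin 3)} {x : ℝ × ℝ}
    (h : tangentComponent v x = 0) : ∃ r : ℝ, v = r • spherePoint x := by
  obtain ⟨h₁, h₂⟩ := Complex.ext_iff.1 h
  simp only [tangentComponent, Complex.zero_re, Complex.zero_im] at h₁ h₂
  have hθ := Real.sin_sq_add_cos_sq x.1
  have hφ := Real.sin_sq_add_cos_sq x.2
  set m := v 0 * Real.cos x.1 + v 1 * Real.sin x.1 with hm
  have hr : (Real.cos x.2 * m + v 2 * Real.sin x.2) * Real.cos x.2 = m := by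
    linear_combination m * hφ + Real.sin x.2 * h₂
  refine ⟨Real.cos x.2 * m + v 2 * Real.sin x.2, ?_⟩
  ext i
  fin_cases i <;> simp [spherePoint]
  · linear_combination -Real.cos x.1 * hr - v 0 * hθ - Real.sin x.1 * h₁ + Real.cos x.1 * hm
  · linear_combination -Real.sin x.1 * hr - v 1 * hθ + Real.cos x.1 * h₁ + Real.sin x.1 * hm
  · linear_combination -v 2 * hφ + Real.cos x.2 * h₂

/-- A continuous vector field along the unit sphere is normal to the sphere at some point. -/
lemma exists_eq_smul_of_continuousOn_sphere
    {V : EuclideanSpace ℝ (Fin 3) → EuclideanSpace ℝ (Fin 3)}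
    (hV : ContinuousOn V (Metric.sphere (0 : EuclideanSpace ℝ (Fin 3)) 1)) :
    ∃ W ∈ Metric.sphere (0 : EuclideanSpace ℝ (Fin 3)) 1, ∃ r : ℝ, V W = r • W := by
  by_contra hcon
  have hcomp : Continuous fun x ↦ V (spherePoint x) :=
    hV.comp_continuous continuous_spherePoint spherePoint_mem_sphere
  have hpole : ∀ θ φ : ℝ, Real.cos φ = 0 → spherePoint (θ, φ) = spherePoint (0, φ) := by
    intro θ φ h
    simp [spherePoint, h]
  refine not_exists_homotopy_exp_neg (H := fun x ↦ tangentComponent (V (spherePoint x)) x)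
    (a := Real.pi / 2) (b := -(Real.pi / 2))
    (c := ⟨V (spherePoint (0, Real.pi / 2)) 1, -V (spherePoint (0, Real.pi / 2)) 0⟩)
    (d := ⟨V (spherePoint (0, -(Real.pi / 2))) 1, V (spherePoint (0, -(Real.pi / 2))) 0⟩)
    ?_ ?_ ?_ ?_ ?_
  · exact continuous_tangentComponent hcomp
  · intro x hx
    exact hcon ⟨_, spherePoint_mem_sphere x, exists_eq_smul_of_tangentComponent_eq_zero hx⟩
  · intro θ φ
    simp [spherePoint, tangentComponent]
  · intro θ
    dsimp only
    rw [hpole θ _ (by simp)]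
    apply Complex.ext <;>
      simp [tangentComponent, Complex.exp_re, Complex.exp_im]; ring
  · intro θ
    dsimp only
    rw [hpole θ _ (by simp)]
    apply Complex.ext <;>
      simp [tangentComponent, Complex.exp_re, Complex.exp_im] <;> ring

/-- A globally convex congruence is spacefilling: if U is a continuous tangent vector
field on the unit sphere S² ⊂ ℝ³ (the perpendicular-displacement section of the line
congruence), then every point p ∈ ℝ³ lies on one of the lines {U(W) + rW : r ∈ ℝ}. -/
theorem globally_convex_congruence_spacefilling
    (U : EuclideanSpace ℝ (Fin 3) → EuclideanSpace ℝ (Fin 3))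
    (hU : ContinuousOn U (Metric.sphere (0 : EuclideanSpace ℝ (Fin 3)) 1))
    (htan : ∀ W ∈ Metric.sphere (0 : EuclideanSpace ℝ (Fin 3)) 1, ⟪U W, W⟫ = 0)
    (p : EuclideanSpace ℝ (Fin 3)) :
    ∃ W ∈ Metric.sphere (0 : EuclideanSpace ℝ (Fin 3)) 1, ∃ r : ℝ, p = U W + r • W := by
  obtain ⟨W, hW, r, h⟩ :=
    exists_eq_smul_of_continuousOn_sphere (V := fun W ↦ p - U W) (continuousOn_const.sub hU)
  exact ⟨W, hW, r, by rw [← h]; abel⟩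
end

section
/- Let F, ξ : ℝ² → ℂ be C¹, r ∈ ℝ, and suppose D = ∂⁻F·conj(∂⁻F) − ∂⁺F·conj(∂⁺F) ≠ 0 at a point (u,v). Then the shear σ = (conj(∂⁺F)·conj(∂̄ξ) − conj(∂⁻F)·conj(∂ξ))/D vanishes at (u,v) if and only if ∂ξ·∂̄F − ∂̄ξ·∂F = 0 at (u,v); the latter is the condition that (u,v) maps to a complex point of the surface Σ ⊂ T ℙ¹ parametrized by ν = u+iv ↦ (ξ, F). -/
open Complex
open scoped ComplexConjugate

/-- The `r`- and `F`-dependent corrections in `dplus` and `dminus` cancel in the shear. -/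
theorem sigmaC_eq_conj_div (F ξ : ℝ × ℝ → ℂ) (r : ℝ) (p : ℝ × ℝ) :
    sigmaC F ξ r p = -conj (wd ξ p * wdb F p - wdb ξ p * wd F p) / Dq F ξ r p := by
  have h : dplus F ξ r p * wdb ξ p - dminus F ξ r p * wd ξ p =
      -(wd ξ p * wdb F p - wdb ξ p * wd F p) := by
    unfold dplus dminus
    ring
  rw [sigmaC, ← map_mul, ← map_mul, ← map_sub, h, map_neg]

/-- The shear σ vanishes at (u,v) iff ∂ξ·∂̄F − ∂̄ξ·∂F = 0 there, i.e. iff (u,v) maps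
to a complex point of the surface Σ ⊂ T ℙ¹ parametrized by ν = u+iv ↦ (ξ, F). -/
theorem shear_free_iff_complex_point
    (F ξ : ℝ × ℝ → ℂ) (hF : ContDiff ℝ 1 F) (hξ : ContDiff ℝ 1 ξ)
    (r : ℝ) (p : ℝ × ℝ) (hD : Dq F ξ r p ≠ 0) :
    sigmaC F ξ r p = 0 ↔ wd ξ p * wdb F p - wdb ξ p * wd F p = 0 := by
  rw [sigmaC_eq_conj_div, div_eq_zero_iff, or_iff_left hD, neg_eq_zero, map_eq_zero]
end
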